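/- arXiv:1705.05083 — 3 statements merged into one kernel-verified Lean document; each statement's English description precedes it below -/
import Mathlib

section
/- Let G be a finite group, N a normal subgroup of G such that the quotient G/N is abelian, and let χ be a complex irreducible character of G. Then the inner product ⟨Res_N χ, Res_N χ⟩_N (of the restriction of χ to N with itself) equals the number of linear characters η of G with N contained in ker(η) and satisfying η·χ = χ (pointwise product of class functions). -/
open scoped BigOperators

/-- The standard inner product of complex class functions on a finite group:
`⟨f, f'⟩ = |G|⁻¹ ∑_{g ∈ G} f g * conj (f' g)`. -/
noncomputable def charInner (G : Type) [Group G] [Finite G] (f f' : G → ℂ) : ℂ :=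
  (Nat.card G : ℂ)⁻¹ * ∑ᶠ g : G, f g * (starRingEnd ℂ) (f' g)

/-- `χ : G → ℂ` is an irreducible character if it is the character of some
irreducible (simple) finite-dimensional complex representation of `G`. -/
def IsIrreducibleCharacter (G : Type) [Group G] (χ : G → ℂ) : Prop :=
  ∃ V : FDRep ℂ G, CategoryTheory.Simple V ∧ χ = V.character

open scoped ComplexOrder in
/-- Over `ℂ`, the trace of a matrix representation of a finite group at `g⁻¹` is the complex
conjugate of its trace at `g`. -/
theorem trace_map_inv_eq_conj_trace {G : Type*} [Group G] [Finite G] {n : Type*} [Fintype n]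
    [DecidableEq n] (ρ : G →* Matrix n n ℂ) (g : G) :
    (ρ g⁻¹).trace = (starRingEnd ℂ) (ρ g).trace := by
  classical
  have := Fintype.ofFinite G
  set P : Matrix n n ℂ := ∑ h : G, (ρ h).conjTranspose * ρ h with hP
  have hpos : P.PosDef := by
    rw [hP, ← Finset.add_sum_erase _ _ (Finset.mem_univ (1 : G))]
    refine Matrix.PosDef.add_posSemidef (by simpa using Matrix.PosDef.one) ?_
    exact Matrix.posSemidef_sum _ fun h _ => Matrix.posSemidef_conjTranspose_mul_self _
  have hunit : IsUnit P.det := (Matrix.isUnit_iff_isUnit_det _).mp hpos.isUnit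
  have hinv : (ρ g).conjTranspose * P * ρ g = P := by
    rw [hP, Finset.mul_sum, Finset.sum_mul,
      ← Equiv.sum_comp (Equiv.mulRight g) fun h => (ρ h).conjTranspose * ρ h]
    refine Finset.sum_congr rfl fun h _ => ?_
    simp [Matrix.mul_assoc]
  have hmul : (ρ g).conjTranspose * P = P * ρ g⁻¹ := by
    nth_rewrite 2 [← hinv]
    rw [Matrix.mul_assoc _ (ρ g), ← map_mul, mul_inv_cancel, map_one, Matrix.mul_one]
  calc (ρ g⁻¹).trace = (P⁻¹ * (P * ρ g⁻¹)).trace := by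
        rw [Matrix.nonsing_inv_mul_cancel_left _ _ hunit]
    _ = (ρ g).conjTranspose.trace := by
        rw [← hmul, Matrix.trace_mul_comm, Matrix.mul_nonsing_inv_cancel_right _ _ hunit]
    _ = _ := by rw [Matrix.trace_conjTranspose]; rfl

namespace FDRep

theorem char_inv_eq_conj {G : Type} [Group G] [Finite G] (V : FDRep ℂ G) (g : G) :
    V.character g⁻¹ = (starRingEnd ℂ) (V.character g) := by
  classical
  let b := Module.finBasis ℂ V
  have h := trace_map_inv_eq_conj_trace
    ((LinearMap.toMatrixAlgEquiv b).toMulEquiv.toMonoidHom.comp V.ρ) g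
  simpa [character, LinearMap.trace_eq_matrix_trace ℂ b, LinearMap.toMatrixAlgEquiv] using h

/-- The twist `η ⊗ V` of a representation `V` by a linear character `η`. -/
noncomputable def twist {G : Type} [Group G] (η : G →* ℂˣ) (V : FDRep ℂ G) : FDRep ℂ G :=
  FDRep.of (V := V)
    { toFun := fun g => (η g : ℂ) • V.ρ g
      map_one' := by simp
      map_mul' := fun g h => by
        rw [smul_mul_smul_comm, map_mul, map_mul, Units.val_mul] }

theorem char_twist {G : Type} [Group G] (η : G →* ℂˣ) (V : FDRep ℂ G) (g : G) :
    (twist η V).character g = (η g : ℂ) * V.character g :=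
  map_smul (LinearMap.trace ℂ V) (η g : ℂ) (V.ρ g)

theorem simple_twist {G : Type} [Group G] [Finite G] (η : G →* ℂˣ) (V : FDRep ℂ G)
    [CategoryTheory.Simple V] : CategoryTheory.Simple (twist η V) := by
  have := Fintype.ofFinite G
  rw [simple_iff_char_is_norm_one, ← (simple_iff_char_is_norm_one V).mp ‹_›]
  refine Finset.sum_congr rfl fun g _ => ?_
  rw [char_twist, char_twist, mul_mul_mul_comm, ← Units.val_mul, ← map_mul]
  simp

open scoped Classical in
theorem inner_twist_char {G : Type} [Group G] [Fintype G] (η : G →* ℂˣ) (V : FDRep ℂ G)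
    [CategoryTheory.Simple V] :
    (Nat.card G : ℂ)⁻¹ * ∑ g : G, (η g : ℂ) * V.character g * V.character g⁻¹ =
      if (fun g => (η g : ℂ) * V.character g) = V.character then 1 else 0 := by
  have hcard : (Nat.card G : ℂ) ≠ 0 := Nat.cast_ne_zero.mpr Nat.card_pos.ne'
  have := invertibleOfNonzero hcard
  have := simple_twist η V
  split_ifs with h
  · simp_rw [fun g => congrFun h g]
    rw [(simple_iff_char_is_norm_one V).mp ‹_›, inv_mul_cancel₀ hcard]
  · have horth := char_orthonormal (twist η V) V
    simp_rw [char_twist] at horth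
    rw [horth, if_neg]
    rintro ⟨i⟩
    exact h (funext fun g => by rw [← char_twist, char_iso i])

end FDRep

open scoped Classical in
theorem CommGroup.sum_linear_characters_apply {A : Type*} [CommGroup A] [Finite A]
    [Fintype (A →* ℂˣ)] (a : A) :
    ∑ φ : A →* ℂˣ, (φ a : ℂ) = if a = 1 then (Nat.card A : ℂ) else 0 := by
  have : NeZero (Monoid.exponent A) := ⟨Monoid.exponent_ne_zero_of_finite⟩
  split_ifs with ha
  · simp [ha, ← Nat.card_eq_fintype_card, CommGroup.card_monoidHom_of_hasEnoughRootsOfUnity A ℂ]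
  · obtain ⟨ψ, hψ⟩ := CommGroup.exists_apply_ne_one_of_hasEnoughRootsOfUnity A ℂ ha
    refine eq_zero_of_mul_eq_self_left (b := (ψ a : ℂ)) (by simpa using hψ) ?_
    rw [Finset.mul_sum]
    exact Fintype.sum_bijective _ (Group.mulLeft_bijective ψ) _ _ fun φ => by simp

/-- Let `N ⊴ G` with `G/N` abelian and `χ` an irreducible character of the finite
group `G`. Then `⟨Res_N χ, Res_N χ⟩_N` equals the number of linear characters
`η : G →* ℂˣ` with `N ⊆ ker η` and `η · χ = χ`. -/
theorem inner_res_eq_card_stabilizing_linear_characters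
    (G : Type) [Group G] [Finite G] (N : Subgroup G) [N.Normal]
    (hab : ∀ a b : G ⧸ N, a * b = b * a)
    (χ : G → ℂ) (hχ : IsIrreducibleCharacter G χ) :
    charInner N (fun n : N => χ n) (fun n : N => χ n) =
      Nat.card {η : G →* ℂˣ //
        (∀ n ∈ N, η n = 1) ∧ (fun g => (η g : ℂ) * χ g) = χ} := by
  classical
  obtain ⟨V, hV, rfl⟩ := hχ
  have := Fintype.ofFinite G
  let _ : CommGroup (G ⧸ N) := { (inferInstance : Group (G ⧸ N)) with mul_comm := hab }
  have : Finite (G ⧸ N →* ℂˣ) := inferInstance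
  have := Fintype.ofFinite (G ⧸ N →* ℂˣ)
  let π := QuotientGroup.mk' N
  have hN : (Nat.card N : ℂ) ≠ 0 := Nat.cast_ne_zero.mpr Nat.card_pos.ne'
  have hQ : (Nat.card (G ⧸ N) : ℂ) ≠ 0 := Nat.cast_ne_zero.mpr Nat.card_pos.ne'
  let e : {φ : G ⧸ N →* ℂˣ //
        (fun g => (φ.comp π g : ℂ) * V.character g) = V.character} ≃
      {η : G →* ℂˣ // (∀ n ∈ N, η n = 1) ∧
        (fun g => (η g : ℂ) * V.character g) = V.character} :=
    { toFun := fun φ => ⟨φ.1.comp π, fun n hn => by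
        simp [π, (QuotientGroup.eq_one_iff n).mpr hn], φ.2⟩
      invFun := fun η => ⟨QuotientGroup.lift N η.1 η.2.1, η.2.2⟩
      left_inv := fun φ => by ext; rfl
      right_inv := fun η => by ext; rfl }
  rw [← Nat.card_congr e, Nat.card_eq_fintype_card, Fintype.card_subtype, Finset.card_filter]
  push_cast
  simp_rw [← FDRep.inner_twist_char]
  rw [← Finset.mul_sum, Finset.sum_comm, charInner, finsum_eq_sum_of_fintype]
  simp_rw [mul_assoc, ← Finset.sum_mul]
  have hsum (g : G) : ∑ φ : G ⧸ N →* ℂˣ, (φ.comp π g : ℂ) =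
      if g ∈ N then (Nat.card (G ⧸ N) : ℂ) else 0 := by
    simpa [π] using CommGroup.sum_linear_characters_apply (g : G ⧸ N)
  simp_rw [hsum, ite_mul, zero_mul, ← FDRep.char_inv_eq_conj]
  rw [← Finset.sum_filter, ← Finset.mul_sum,
    Finset.sum_subtype (p := (· ∈ N)) _ (by simp), Subgroup.card_eq_card_quotient_mul_card_subgroup N]
  push_cast
  field_simp
end

section
/- Let G be a finite group, N a normal subgroup of G with G/N abelian, and let χ, χ' be complex irreducible characters of G. If there exists an irreducible character φ of N with ⟨Res_N χ, φ⟩_N ≠ 0 and ⟨Res_N χ', φ⟩_N ≠ 0, then Res_N χ = Res_N χ' and there exists a linear character η of G with N ⊆ ker(η) such that χ' = η·χ. Conversely, if χ' = η·χ for some linear character η of G trivial on N, then Res_N χ = Res_N χ'. -/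
open scoped BigOperators

open CategoryTheory Representation

/-- A pairwise commuting family of endomorphisms of a nonzero finite-dimensional vector space over
an algebraically closed field has a common eigenvector. -/
theorem exists_common_eigenvector_of_commute {k ι : Type*} [Field k] [IsAlgClosed k] {W : Type*}
    [AddCommGroup W] [Module k W] [FiniteDimensional k W] [Nontrivial W]
    (T : ι → Module.End k W) (hT : ∀ i j, Commute (T i) (T j)) :
    ∃ w : W, w ≠ 0 ∧ ∀ i, ∃ c : k, T i w = c • w := by
  obtain ⟨p, ⟨hp0, hp⟩, hmin⟩ := (wellFounded_lt (α := Submodule k W)).has_min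
    {p | p ≠ ⊥ ∧ ∀ i, ∀ x ∈ p, T i x ∈ p} ⟨⊤, top_ne_bot, fun _ _ _ => trivial⟩
  obtain ⟨w, hwp, hw⟩ := p.exists_mem_ne_zero_of_ne_bot hp0
  refine ⟨w, hw, fun i => ?_⟩
  have : Nontrivial p := Submodule.nontrivial_iff_ne_bot.2 hp0
  obtain ⟨c, hc⟩ := Module.End.exists_eigenvalue ((T i).restrict (hp i))
  obtain ⟨v, hv⟩ := hc.exists_hasEigenvector
  have hv' : T i v = c • (v : W) := congrArg Subtype.val hv.apply_eq_smul
  refine ⟨c, Module.End.mem_eigenspace_iff.1 ?_⟩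
  by_contra hcon
  refine hmin (p ⊓ (T i).eigenspace c) ⟨?_, fun j x hx => ⟨hp j x hx.1, ?_⟩⟩ ?_
  · exact (Submodule.ne_bot_iff _).2
      ⟨v, ⟨v.2, Module.End.mem_eigenspace_iff.2 hv'⟩, fun h => hv.2 (Subtype.ext h)⟩
  · have hx2 := Module.End.mem_eigenspace_iff.1 hx.2
    refine Module.End.mem_eigenspace_iff.2 ?_
    rw [← Module.End.mul_apply, (hT i j).eq, Module.End.mul_apply, hx2, map_smul]
  · exact lt_of_le_of_ne inf_le_left fun h => hcon (h.symm.le hwp).2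

open scoped Matrix ComplexOrder in
/-- A complex matrix representation of a finite group preserves a positive definite form, so the
trace of an inverse is the complex conjugate of the trace. -/
theorem Matrix.trace_map_inv_eq_star {G n : Type*} [Group G] [Finite G] [Fintype n] [DecidableEq n]
    (R : G →* Matrix n n ℂ) (g : G) : (R g⁻¹).trace = star (R g).trace := by
  cases nonempty_fintype G
  set H : Matrix n n ℂ := ∑ h, (R h)ᴴ * R h
  have hinv : ∀ h, R h⁻¹ * R h = 1 := fun h => by rw [← map_mul, inv_mul_cancel, map_one]
  have hinv' : ∀ h, R h * R h⁻¹ = 1 := fun h => by rw [← map_mul, mul_inv_cancel, map_one]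
  have hH : H.PosDef := by
    refine Matrix.posDef_sum ⟨1, Finset.mem_univ _⟩ fun h _ => ?_
    exact Matrix.PosDef.conjTranspose_mul_self _ (Matrix.mulVec_injective_of_isUnit
      (IsUnit.of_mul_eq_one _ (hinv' h)))
  have hdet := (Matrix.isUnit_iff_isUnit_det _).1 hH.isUnit
  have hg : (R g)ᴴ * H * R g = H := by
    simp only [H, Finset.mul_sum, Finset.sum_mul]
    refine Fintype.sum_equiv (Equiv.mulRight g) _ _ fun h => ?_
    simp [Matrix.conjTranspose_mul, mul_assoc]
  have hconj : (R g)ᴴ = H * R g⁻¹ * H⁻¹ := by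
    calc (R g)ᴴ = (R g)ᴴ * H * (R g * R g⁻¹) * H⁻¹ := by
          rw [hinv', mul_one, Matrix.mul_nonsing_inv_cancel_right _ _ hdet]
      _ = ((R g)ᴴ * H * R g) * R g⁻¹ * H⁻¹ := by simp only [mul_assoc]
      _ = _ := by rw [hg]
  rw [← Matrix.trace_conjTranspose, hconj, Matrix.trace_mul_comm,
    Matrix.nonsing_inv_mul_cancel_left _ _ hdet]

/-- The value of a complex character of a finite group at an inverse is the complex conjugate. -/
theorem FDRep.character_inv_eq_conj {G : Type} [Group G] [Finite G] (V : FDRep ℂ G) (g : G) :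
    V.character g⁻¹ = (starRingEnd ℂ) (V.character g) := by
  let b := Module.finBasis ℂ V
  have := Matrix.trace_map_inv_eq_star
    ((MonoidHomClass.toMonoidHom (LinearMap.toMatrixAlgEquiv b)).comp V.ρ) g
  simp only [FDRep.character, LinearMap.trace_eq_matrix_trace ℂ b]
  exact this

/-- The inner product of two characters is the dimension of the space of equivariant maps. -/
theorem charInner_character {G : Type} [Group G] [Finite G] (V W : FDRep ℂ G) :
    charInner G W.character V.character = Module.finrank ℂ (V ⟶ W) := by
  cases nonempty_fintype G
  have : Invertible (Nat.card G : ℂ) := invertibleOfNonzero (NeZero.ne _)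
  rw [← FDRep.scalar_product_char_eq_finrank_equivariant, charInner, finsum_eq_sum_of_fintype]
  simp only [FDRep.character_inv_eq_conj]

/-- Two representations of a finite group with a common irreducible constituent admit a nonzero
equivariant map between them. -/
theorem FDRep.exists_hom_ne_zero_of_common_constituent {G : Type} [Group G] [Finite G]
    (S V W : FDRep ℂ G) [Simple S] (hV : charInner G V.character S.character ≠ 0)
    (hW : charInner G W.character S.character ≠ 0) : ∃ f : V ⟶ W, f ≠ 0 := by
  rw [charInner_character, Nat.cast_ne_zero, ← Nat.pos_iff_ne_zero,
    Module.finrank_pos_iff_exists_ne_zero] at hV hW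
  obtain ⟨a, ha⟩ := hV
  obtain ⟨b, hb⟩ := hW
  have := mono_of_nonzero_from_simple ha
  refine ⟨Injective.factorThru b a, fun h => hb ?_⟩
  rw [← Injective.comp_factorThru b a, h, Limits.comp_zero]

/-- The restriction of a representation to a subgroup. -/
noncomputable abbrev FDRep.restrict {G : Type} [Group G] (V : FDRep ℂ G) (N : Subgroup G) :
    FDRep ℂ N :=
  FDRep.of (V.ρ.comp N.subtype)

/-- The twist of a representation by a linear character. -/
noncomputable abbrev FDRep.twist_s3 {G : Type} [Group G] (V : FDRep ℂ G) (η : G →* ℂˣ) :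
    FDRep ℂ G :=
  FDRep.of
    { toFun g := (η g : ℂ) • V.ρ g
      map_one' := by simp
      map_mul' g h := by rw [map_mul, map_mul, Units.val_mul, smul_mul_smul_comm] }

theorem FDRep.character_twist {G : Type} [Group G] (V : FDRep ℂ G) (η : G →* ℂˣ) (g : G) :
    (V.twist_s3 η).character g = η g * V.character g :=
  map_smul (LinearMap.trace ℂ V) _ _

theorem FDRep.simple_twist_s3 {G : Type} [Group G] [Finite G] (V : FDRep ℂ G) [hV : Simple V]
    (η : G →* ℂˣ) : Simple (V.twist_s3 η) := by
  cases nonempty_fintype G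
  rw [FDRep.simple_iff_char_is_norm_one] at hV ⊢
  rw [← hV]
  refine Finset.sum_congr rfl fun g _ => ?_
  rw [FDRep.character_twist, FDRep.character_twist, mul_mul_mul_comm, ← Units.val_mul, ← map_mul,
    mul_inv_cancel, map_one, Units.val_one, one_mul]

/-- If `G ⧸ N` is abelian and there is a nonzero `N`-equivariant map from `V` to `W`, then some
such map spans a line on which `G` acts by conjugation through a linear character of `G ⧸ N`. -/
theorem FDRep.exists_semi_invariant_hom {G : Type} [Group G] (N : Subgroup G) [N.Normal]
    (hab : ∀ a b : G ⧸ N, a * b = b * a) (V W : FDRep ℂ G)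
    (h : ∃ f : V.restrict N ⟶ W.restrict N, f ≠ 0) :
    ∃ (η : G →* ℂˣ) (f : V →ₗ[ℂ] W), (∀ n ∈ N, η n = 1) ∧ f ≠ 0 ∧
      ∀ g, linHom V.ρ W.ρ g f = (η g : ℂ) • f := by
  obtain ⟨f₀, hf₀⟩ := h
  let U := invariants ((linHom V.ρ W.ρ).comp N.subtype)
  let u₀ : U := (linHom.invariantsEquivFDRepHom (V.restrict N) (W.restrict N)).symm f₀
  have hu₀ : u₀ ≠ 0 := (LinearEquiv.map_ne_zero_iff _).2 hf₀
  have : Nontrivial U := ⟨u₀, 0, hu₀⟩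
  let T := quotientToInvariants (linHom V.ρ W.ρ) N
  obtain ⟨w, hw, hc⟩ := exists_common_eigenvector_of_commute T fun a b => by
    rw [Commute, SemiconjBy, ← map_mul, ← map_mul, hab]
  choose c hc using hc
  let η' : G ⧸ N →* ℂ :=
    { toFun := c
      map_one' := smul_left_injective ℂ hw <| by
        simp only [← hc, map_one, Module.End.one_apply, one_smul]
      map_mul' a b := smul_left_injective ℂ hw <| by
        simp only [← hc, map_mul, Module.End.mul_apply]
        rw [hc b, map_smul, hc a, smul_smul, mul_comm] }
  refine ⟨η'.toHomUnits.comp (QuotientGroup.mk' N), w, fun n hn => ?_, ?_, fun g => ?_⟩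
  · rw [MonoidHom.comp_apply, QuotientGroup.mk'_apply, (QuotientGroup.eq_one_iff n).2 hn, map_one]
  · exact fun h => hw (Subtype.ext h)
  · exact congrArg Subtype.val (hc (g : G ⧸ N))

/-- A nonzero semi-invariant map between irreducible representations exhibits one as a twist of
the other. -/
theorem FDRep.character_eq_of_semi_invariant_hom {G : Type} [Group G] [Finite G]
    (V W : FDRep ℂ G) [Simple V] [Simple W] (η : G →* ℂˣ) (f : V →ₗ[ℂ] W) (hf : f ≠ 0)
    (h : ∀ g, linHom V.ρ W.ρ g f = (η g : ℂ) • f) :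
    W.character = fun g => (η g : ℂ) * V.character g := by
  have hmem : f ∈ (linHom (V.twist_s3 η).ρ W.ρ).invariants := fun g => by
    have h1 : linHom (V.twist_s3 η).ρ W.ρ g f = (η g⁻¹ : ℂ) • linHom V.ρ W.ρ g f := by
      ext v
      exact map_smul ((W.ρ g).comp f) _ _
    rw [h1, h, smul_smul, ← Units.val_mul, ← map_mul, inv_mul_cancel, map_one, Units.val_one,
      one_smul]
  let F := linHom.invariantsEquivFDRepHom (V.twist_s3 η) W ⟨f, hmem⟩
  have hF : F ≠ 0 := (LinearEquiv.map_ne_zero_iff _).2 fun h => hf (congrArg Subtype.val h)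
  have := V.simple_twist_s3 η
  have := isIso_of_hom_simple hF
  rw [← FDRep.char_iso (asIso F)]
  exact funext (V.character_twist η)

/-- Let `N ⊴ G` with `G/N` abelian and `χ, χ'` irreducible characters of the
finite group `G`. If the restrictions of `χ` and `χ'` to `N` have a common
irreducible constituent, then these restrictions are equal and `χ' = η · χ`
for some linear character `η` of `G` trivial on `N`. Conversely, if
`χ' = η · χ` for a linear character `η` trivial on `N`, then the restrictions
to `N` are equal. -/
theorem restriction_common_constituent_dichotomy
    (G : Type) [Group G] [Finite G] (N : Subgroup G) [N.Normal]
    (hab : ∀ a b : G ⧸ N, a * b = b * a)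
    (χ χ' : G → ℂ) (hχ : IsIrreducibleCharacter G χ)
    (hχ' : IsIrreducibleCharacter G χ') :
    ((∃ φ : N → ℂ, IsIrreducibleCharacter N φ ∧
        charInner N (fun n : N => χ n) φ ≠ 0 ∧
        charInner N (fun n : N => χ' n) φ ≠ 0) →
      ((fun n : N => χ n) = (fun n : N => χ' n) ∧
        ∃ η : G →* ℂˣ, (∀ n ∈ N, η n = 1) ∧ χ' = fun g => (η g : ℂ) * χ g)) ∧
    (∀ η : G →* ℂˣ, (∀ n ∈ N, η n = 1) →
      χ' = (fun g => (η g : ℂ) * χ g) →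
      (fun n : N => χ n) = (fun n : N => χ' n)) := by
  have hconv : ∀ η : G →* ℂˣ, (∀ n ∈ N, η n = 1) → χ' = (fun g => (η g : ℂ) * χ g) →
      (fun n : N => χ n) = (fun n : N => χ' n) := by
    rintro η hη rfl
    funext n
    simp [hη n n.2]
  refine ⟨?_, hconv⟩
  rintro ⟨φ, ⟨S, hS, rfl⟩, hφ, hφ'⟩
  obtain ⟨V, hV, rfl⟩ := hχ
  obtain ⟨W, hW, rfl⟩ := hχ'
  obtain ⟨η, f, hη, hf, h⟩ := FDRep.exists_semi_invariant_hom N hab V W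
    (FDRep.exists_hom_ne_zero_of_common_constituent S (V.restrict N) (W.restrict N) hφ hφ')
  have heq := FDRep.character_eq_of_semi_invariant_hom V W η f hf h
  exact ⟨hconv η hη heq, η, hη, heq⟩
end

section
/- Let q be a prime power, F a finite field with q elements, and n ≥ 1. For every complex irreducible character χ̃ of the general linear group GL_n(F) and every complex irreducible character ρ of the special linear group SL_n(F), the multiplicity ⟨Res χ̃, ρ⟩ of ρ in the restriction of χ̃ to SL_n(F) is at most 1; that is, the restriction of any irreducible complex character of GL_n(F) to SL_n(F) is multiplicity-free. -/
open scoped BigOperators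

open Module CategoryTheory

namespace Representation

section EigenUnits

variable {G k V : Type*} [Group G] [Field k] [AddCommGroup V] [Module k V]
  {ρ : Representation k G V} {N : Subgroup G}

theorem pow_mul_eq_units_pow_smul {g : G} {T : End k V} {c : kˣ}
    (hc : ρ g * T = c • (T * ρ g)) (m : ℕ) : ρ (g ^ m) * T = c ^ m • (T * ρ (g ^ m)) := by
  induction m with
  | zero => simp
  | succ m ih =>
    rw [pow_succ' g, map_mul, mul_assoc, ih, mul_smul_comm, ← mul_assoc, hc, smul_mul_assoc,
      smul_smul, mul_assoc, pow_succ]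

/-- If `T` commutes with `N` and is an eigenvector for conjugation by an element generating
`G` modulo `N`, then every `ρ x` commutes with `T` up to a nonzero scalar. -/
theorem exists_units_smul_of_eigenvector {g : G}
    (hg : ∀ x : G, ∃ m : ℕ, ∃ n ∈ N, x = g ^ m * n) {T : End k V}
    (hT : ∀ n ∈ N, Commute (ρ n) T) {c : kˣ} (hc : ρ g * T = c • (T * ρ g)) (x : G) :
    ∃ d : kˣ, ρ x * T = d • (T * ρ x) := by
  obtain ⟨m, n, hn, rfl⟩ := hg x
  refine ⟨c ^ m, ?_⟩
  rw [map_mul, mul_assoc, (hT n hn).eq, ← mul_assoc, pow_mul_eq_units_pow_smul hc,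
    smul_mul_assoc, mul_assoc]

/-- A nonzero operator commuting up to nonzero scalars with an irreducible representation is
invertible. -/
theorem IsIrreducible.isUnit_of_units_smul [FiniteDimensional k V] [IsIrreducible ρ]
    {T : End k V} (hT : ∀ x, ∃ d : kˣ, ρ x * T = d • (T * ρ x)) (h0 : T ≠ 0) : IsUnit T := by
  let K : Subrepresentation ρ :=
    { toSubmodule := LinearMap.ker T
      apply_mem_toSubmodule := fun x v hv ↦ by
        obtain ⟨d, hd⟩ := hT x
        have h := LinearMap.congr_fun hd v
        simp only [End.mul_apply, LinearMap.smul_apply, LinearMap.mem_ker.1 hv, map_zero] at h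
        exact (smul_eq_zero_iff_eq d).1 h.symm }
  rw [LinearMap.isUnit_iff_ker_eq_bot]
  rcases eq_bot_or_eq_top K with h | h
  · exact congrArg Subrepresentation.toSubmodule h
  · exact absurd (LinearMap.ker_eq_top.1 (congrArg Subrepresentation.toSubmodule h)) h0

/-- Schur's lemma for operators commuting with an irreducible representation. -/
theorem IsIrreducible.exists_eq_smul_one [FiniteDimensional k V] [IsAlgClosed k]
    [IsIrreducible ρ] {T : End k V} (hT : ∀ x, ρ x * T = T * ρ x) : ∃ c : k, T = c • 1 := by
  obtain ⟨c, hc⟩ := (IsIrreducible.algebraMap_intertwiningMap_bijective_of_isAlgClosed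
    (ρ := ρ)).2 ⟨T, fun x ↦ (hT x).symm⟩
  exact ⟨c, (congrArg IntertwiningMap.toLinearMap hc).symm⟩

variable (ρ N) in
/-- The group of pairs `(c, T)` with `T` an invertible operator commuting with `N` and
`ρ g * T * (ρ g)⁻¹ = c • T`. -/
def eigenUnits (g : G) : Subgroup (kˣ × (End k V)ˣ) where
  carrier := {p | (∀ n ∈ N, Commute (ρ n) p.2) ∧ ρ g * p.2 = p.1 • ((p.2 : End k V) * ρ g)}
  one_mem' := by simp
  mul_mem' := by
    rintro ⟨c, S⟩ ⟨d, T⟩ ⟨hS, hc⟩ ⟨hT, hd⟩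
    refine ⟨fun n hn ↦ (hS n hn).mul_right (hT n hn), ?_⟩
    dsimp only at hc hd ⊢
    simp only [Prod.mk_mul_mk, Units.val_mul]
    rw [← mul_assoc, hc, smul_mul_assoc, mul_assoc, hd, mul_smul_comm, smul_smul, mul_assoc]
  inv_mem' := by
    rintro ⟨c, T⟩ ⟨hT, hc⟩
    refine ⟨fun n hn ↦ (hT n hn).units_inv_right, ?_⟩
    dsimp only at hc ⊢
    rw [Prod.fst_inv, Prod.snd_inv, eq_inv_smul_iff, Units.eq_inv_mul_iff_mul_eq, mul_smul_comm,
      ← mul_assoc, ← smul_mul_assoc, ← hc, Units.mul_inv_cancel_right]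

/-- The group of invertible eigenvectors is commutative: modulo scalars it is a group of roots of
unity. -/
theorem eigenUnits_commute [Finite G] [FiniteDimensional k V] [IsAlgClosed k]
    [IsIrreducible ρ] {g : G} (hg : ∀ x : G, ∃ m : ℕ, ∃ n ∈ N, x = g ^ m * n)
    (p q : eigenUnits ρ N g) : p * q = q * p := by
  have : Nontrivial V := IsSimpleModule.nontrivial (MonoidAlgebra k G) ρ.asModule
  have : NeZero (Nat.card G) := ⟨Nat.card_pos.ne'⟩
  let f : eigenUnits ρ N g →* rootsOfUnity (Nat.card G) k :=
    ((MonoidHom.fst _ _).comp (Subgroup.subtype _)).codRestrict _ <| by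
      rintro ⟨⟨c, T⟩, hT, hc⟩
      have h := pow_mul_eq_units_pow_smul hc (Nat.card G)
      rw [pow_card_eq_one', map_one, one_mul, mul_one] at h
      have h' : ((c ^ Nat.card G : kˣ) : k) • (T : End k V) = (1 : k) • (T : End k V) := by
        rw [one_smul]; exact h.symm
      exact Units.ext (smul_left_injective k T.ne_zero h')
  refine (f.isMulCommutative_of_isCyclic_of_ker_le_center ?_).is_comm.comm p q
  rintro ⟨⟨c, T⟩, hT, hc⟩ hf
  have hc1 : c = 1 := congrArg Subtype.val hf
  subst hc1
  obtain ⟨a, ha⟩ := IsIrreducible.exists_eq_smul_one (ρ := ρ) (T := T) fun x ↦ by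
    obtain ⟨m, n, hn, rfl⟩ := hg x
    rw [map_mul, mul_assoc, (hT n hn).eq, ← mul_assoc, pow_mul_eq_units_pow_smul hc,
      one_pow, one_smul, mul_assoc]
  rw [Subgroup.mem_center_iff]
  rintro ⟨⟨d, S⟩, hS⟩
  refine Subtype.ext (Prod.ext (mul_comm _ _) (Units.ext ?_))
  change (S : End k V) * T = T * S
  rw [ha, mul_smul_comm, smul_mul_assoc, mul_one, one_mul]

/-- The operators commuting with a normal subgroup are spanned by the invertible eigenvectors for
conjugation by an element generating the quotient. -/
theorem mem_span_eigenUnits [Finite G] [NeZero (Nat.card G : k)] [FiniteDimensional k V]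
    [IsAlgClosed k] [IsIrreducible ρ] [N.Normal] {g : G}
    (hg : ∀ x : G, ∃ m : ℕ, ∃ n ∈ N, x = g ^ m * n) {T : End k V}
    (hT : ∀ n ∈ N, Commute (ρ n) T) :
    T ∈ Submodule.span k (Set.range fun p : eigenUnits ρ N g ↦ (p.1.2 : End k V)) := by
  let σ : End k (End k V) := linHom ρ ρ g
  have hσ : ∀ S, σ S = ρ g * S * ρ g⁻¹ := fun S ↦ rfl
  have hss : σ.IsSemisimple := by
    refine End.isSemisimple_of_squarefree_aeval_eq_zero (p := Polynomial.X ^ Nat.card G - 1)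
      (Polynomial.X_pow_sub_one_separable_iff.2 (NeZero.ne _)).squarefree ?_
    rw [map_sub, map_pow, Polynomial.aeval_X, map_one, ← map_pow, pow_card_eq_one', map_one,
      sub_self]
  let A : Submodule k (End k V) :=
    { carrier := {S | ∀ n ∈ N, Commute (ρ n) S}
      zero_mem' := fun n _ ↦ Commute.zero_right _
      add_mem' := fun hS hT n hn ↦ (hS n hn).add_right (hT n hn)
      smul_mem' := fun a S hS n hn ↦ (hS n hn).smul_right a }
  have hA : ∀ S ∈ A, σ S ∈ A := by
    intro S hS n hn
    have h := (hS (g⁻¹ * n * g) (by simpa using ‹N.Normal›.conj_mem n hn g⁻¹)).eq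
    have h₁ : ρ n * ρ g = ρ g * ρ (g⁻¹ * n * g) := by rw [← map_mul, ← map_mul]; group
    have h₂ : ρ (g⁻¹ * n * g) * ρ g⁻¹ = ρ g⁻¹ * ρ n := by rw [← map_mul, ← map_mul]; group
    rw [hσ, Commute, SemiconjBy, ← mul_assoc, ← mul_assoc, h₁, mul_assoc (ρ g), h, mul_assoc,
      mul_assoc, h₂]
    simp only [mul_assoc]
  have hTA : T ∈ ⨆ μ, A ⊓ σ.genEigenspace μ 1 := by
    rw [← Submodule.inf_iSup_genEigenspace hA]
    exact ⟨hT, hss.iSup_eigenspace_eq_top ▸ Submodule.mem_top⟩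
  refine (iSup_le fun μ S hS ↦ ?_ : _ ≤ Submodule.span k _) hTA
  by_cases h0 : S = 0
  · rw [h0]; exact zero_mem _
  have hμ : σ S = μ • S := End.mem_eigenspace_iff.1 hS.2
  have hc : ρ g * S = μ • (S * ρ g) := by
    rw [← smul_mul_assoc, ← hμ, hσ, mul_assoc, ← map_mul, inv_mul_cancel, map_one, mul_one]
  have hμ0 : μ ≠ 0 := by
    rintro rfl
    apply h0
    rw [zero_smul] at hc
    have := congrArg (ρ g⁻¹ * ·) hc
    simpa [← mul_assoc, ← map_mul] using this
  obtain ⟨S, rfl⟩ := IsIrreducible.isUnit_of_units_smul (ρ := ρ)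
    (exists_units_smul_of_eigenvector hg hS.1 (c := Units.mk0 μ hμ0) hc) h0
  exact Submodule.subset_span ⟨⟨(Units.mk0 μ hμ0, S), hS.1, hc⟩, rfl⟩

/-- If `N` is normal in `G` with cyclic quotient, the operators commuting with the restriction to
`N` of an irreducible representation of `G` commute with each other. -/
theorem IsIrreducible.commute_of_isCyclic_quotient [Finite G] [NeZero (Nat.card G : k)]
    [FiniteDimensional k V] [IsAlgClosed k] [IsIrreducible ρ] [N.Normal] [IsCyclic (G ⧸ N)]
    {S T : End k V} (hS : ∀ n ∈ N, Commute (ρ n) S) (hT : ∀ n ∈ N, Commute (ρ n) T) :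
    Commute S T := by
  obtain ⟨g, hg⟩ : ∃ g : G, ∀ x : G, ∃ m : ℕ, ∃ n ∈ N, x = g ^ m * n := by
    obtain ⟨y, hy⟩ := IsCyclic.exists_monoid_generator (α := G ⧸ N)
    obtain ⟨g, rfl⟩ := QuotientGroup.mk_surjective y
    refine ⟨g, fun x ↦ ?_⟩
    obtain ⟨m, hm⟩ := hy x
    exact ⟨m, (g ^ m)⁻¹ * x, QuotientGroup.eq.1 hm, by simp⟩
  have hS' := mem_span_eigenUnits hg hS
  have hT' := mem_span_eigenUnits hg hT
  clear hS hT
  induction hS', hT' using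
    Submodule.span_induction₂ with
  | mem_mem S T hS hT =>
    obtain ⟨p, rfl⟩ := hS
    obtain ⟨q, rfl⟩ := hT
    exact congrArg (fun r : eigenUnits ρ N g ↦ (r.1.2 : End k V)) (eigenUnits_commute hg p q)
  | zero_left => exact Commute.zero_left _
  | zero_right => exact Commute.zero_right _
  | add_left _ _ _ _ _ _ h₁ h₂ => exact h₁.add_left h₂
  | add_right _ _ _ _ _ _ h₁ h₂ => exact h₁.add_right h₂
  | smul_left a _ _ _ _ h => exact h.smul_left a
  | smul_right a _ _ _ _ h => exact h.smul_right a

end EigenUnits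

section MultiplicityFree

variable {G k V W : Type*} [Group G] [Field k] [AddCommGroup V] [Module k V]
  [AddCommGroup W] [Module k W] {ρ : Representation k G V} {σ : Representation k G W}

/-- A nonzero intertwining map out of an irreducible representation has a retraction. -/
theorem IsIrreducible.exists_comp_eq_id [Finite G] [NeZero (Nat.card G : k)] [IsIrreducible ρ]
    {f : IntertwiningMap ρ σ} (hf : f ≠ 0) : ∃ p : IntertwiningMap σ ρ, p.comp f = .id ρ := by
  have hinj := (IsIrreducible.injective_or_eq_zero f).resolve_right hf
  obtain ⟨p, hp⟩ := MonoidAlgebra.exists_leftInverse_of_injective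
    (IntertwiningMap.equivLinearMapAsModule ρ σ f) (LinearMap.ker_eq_bot.2 hinj)
  refine ⟨(IntertwiningMap.equivLinearMapAsModule σ ρ).symm p, ?_⟩
  ext v
  exact LinearMap.congr_fun hp v

/-- If the endomorphisms of `σ` commute, every irreducible representation occurs in `σ` with
multiplicity at most one. -/
theorem IsIrreducible.finrank_intertwiningMap_le_one [Finite G] [NeZero (Nat.card G : k)]
    [IsAlgClosed k] [FiniteDimensional k W] [FiniteDimensional k V] [IsIrreducible ρ]
    (hσ : ∀ S T : IntertwiningMap σ σ, S.comp T = T.comp S) :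
    finrank k (IntertwiningMap ρ σ) ≤ 1 := by
  by_cases h : ∃ f : IntertwiningMap ρ σ, f ≠ 0
  swap
  · push Not at h
    have : Subsingleton (IntertwiningMap ρ σ) := ⟨fun f g ↦ (h f).trans (h g).symm⟩
    simp [finrank_zero_of_subsingleton]
  obtain ⟨f, hf⟩ := h
  refine finrank_le_one f fun h ↦ ?_
  by_cases h0 : h = 0
  · exact ⟨0, by simp [h0]⟩
  obtain ⟨p, hp⟩ := exists_comp_eq_id hf
  obtain ⟨q, hq⟩ := exists_comp_eq_id h0
  obtain ⟨c, hc⟩ := (IsIrreducible.algebraMap_intertwiningMap_bijective_of_isAlgClosed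
    (ρ := ρ)).2 (p.comp h)
  refine ⟨c, ?_⟩
  have hp' : ∀ v, p (f v) = v := fun v ↦ congrArg (fun u : IntertwiningMap ρ ρ ↦ u v) hp
  have hq' : ∀ v, q (h v) = v := fun v ↦ congrArg (fun u : IntertwiningMap ρ ρ ↦ u v) hq
  have hc' : ∀ v, p (h v) = c • v := fun v ↦
    congrArg (fun u : IntertwiningMap ρ ρ ↦ u v) hc.symm
  ext v
  have := congrArg (fun u : IntertwiningMap σ σ ↦ u (h v)) (hσ (f.comp q) (h.comp p))
  simpa [hp', hq', hc'] using this

end MultiplicityFree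
end Representation

/-- A simple object of `FDRep k G` is an irreducible representation. -/
theorem FDRep.isIrreducible_of_simple {k : Type*} [Field k] {G : Type*} [Group G] (V : FDRep k G)
    [Simple V] : Representation.IsIrreducible V.ρ := by
  have hV : Nontrivial V := by
    by_contra h
    rw [not_nontrivial_iff_subsingleton] at h
    refine id_nonzero V ?_
    ext x
    exact Subsingleton.elim _ _
  have : Nontrivial (Subrepresentation V.ρ) := by
    refine ⟨⊥, ⊤, fun h ↦ ?_⟩
    exact bot_ne_top (α := Submodule k V) (congrArg Subrepresentation.toSubmodule h)
  refine ⟨fun U ↦ ?_⟩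
  let j : FDRep.of U.toRepresentation ⟶ V :=
    FDRep.forget₂HomLinearEquiv (FDRep.of U.toRepresentation) V
      (Rep.ofHom ⟨U.toSubmodule.subtype, fun g ↦ rfl⟩)
  have hj : ∀ u : U.toSubmodule, j.hom u = (u : V) := fun u ↦ rfl
  have : Mono j := ConcreteCategory.mono_of_injective _ Subtype.val_injective
  by_cases h : j = 0
  · left
    apply Subrepresentation.toSubmodule_injective
    refine (Submodule.eq_bot_iff _).2 fun u hu ↦ ?_
    have := hj ⟨u, hu⟩
    rw [h] at this
    exact this.symm
  · right
    have := isIso_of_mono_of_nonzero h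
    apply Subrepresentation.toSubmodule_injective
    refine (Submodule.eq_top_iff').2 fun v ↦ ?_
    have h2 := congrArg (fun f : V ⟶ V ↦ f.hom v) (IsIso.inv_hom_id j)
    have h3 : j.hom ((inv j).hom v) = v := h2
    rw [← h3]
    exact ((inv j).hom v : U.toSubmodule).2

open scoped ComplexConjugate Matrix ComplexOrder MatrixOrder in
/-- Character values at inverse elements are complex conjugate: the operators are unitary for an
invariant positive definite form. -/
theorem Representation.character_inv {G V : Type*} [Group G] [Finite G] [AddCommGroup V]
    [Module ℂ V] [FiniteDimensional ℂ V] (ρ : Representation ℂ G V) (g : G) :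
    ρ.character g⁻¹ = conj (ρ.character g) := by
  have := Fintype.ofFinite G
  let b := Module.finBasis ℂ V
  let M : G →* Matrix (Fin (finrank ℂ V)) (Fin (finrank ℂ V)) ℂ :=
    (LinearMap.toMatrixAlgEquiv b : End ℂ V →* _).comp ρ
  have htr : ∀ x, ρ.character x = (M x).trace := fun x ↦ LinearMap.trace_eq_matrix_trace ℂ b (ρ x)
  let P := ∑ x : G, (M x)ᴴ * M x
  have hP : P.PosDef := by
    refine Matrix.posDef_sum Finset.univ_nonempty fun x _ ↦
      Matrix.PosDef.conjTranspose_mul_self _ (Matrix.mulVec_injective_iff_isUnit.2 ?_)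
    exact (Group.isUnit x).map M
  have hinv : (M g)ᴴ * P * M g = P := by
    simp only [P, Finset.mul_sum, Finset.sum_mul]
    refine Fintype.sum_equiv (Equiv.mulRight g) _ _ fun x ↦ ?_
    simp [Matrix.mul_assoc]
  have hM : M g * M g⁻¹ = 1 := by rw [← map_mul, mul_inv_cancel, map_one]
  have hPM : (M g)ᴴ * P = P * M g⁻¹ := by
    conv_rhs => rw [← hinv]
    rw [Matrix.mul_assoc, Matrix.mul_assoc, hM, Matrix.mul_one]
  have hu := P.isUnit_iff_isUnit_det.1 hP.isUnit
  rw [htr, htr, starRingEnd_apply, ← Matrix.trace_conjTranspose,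
    ← Matrix.mul_nonsing_inv_cancel_right _ (M g)ᴴ hu, hPM, Matrix.trace_mul_comm,
    ← Matrix.mul_assoc, Matrix.nonsing_inv_mul _ hu, Matrix.one_mul]

/-- If `i : H → G` has normal range with cyclic cokernel, the restriction along `i` of an
irreducible representation of `G` is multiplicity-free. -/
theorem Representation.IsIrreducible.finrank_intertwiningMap_comp_le_one {G H k V W : Type*}
    [Group G] [Group H] [Finite G] [Finite H] [Field k] [CharZero k] [IsAlgClosed k]
    [AddCommGroup V] [Module k V] [FiniteDimensional k V] [AddCommGroup W] [Module k W]
    [FiniteDimensional k W] (i : H →* G) [i.range.Normal] [IsCyclic (G ⧸ i.range)]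
    (ρ : Representation k G V) [IsIrreducible ρ] (σ : Representation k H W) [IsIrreducible σ] :
    finrank k (IntertwiningMap σ (ρ.comp i)) ≤ 1 := by
  have : NeZero (Nat.card G : k) := ⟨Nat.cast_ne_zero.2 Nat.card_pos.ne'⟩
  have : NeZero (Nat.card H : k) := ⟨Nat.cast_ne_zero.2 Nat.card_pos.ne'⟩
  refine finrank_intertwiningMap_le_one fun S T ↦ IntertwiningMap.ext ?_
  have key (S : IntertwiningMap (ρ.comp i) (ρ.comp i)) :
      ∀ n ∈ i.range, Commute (ρ n) S.toLinearMap := by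
    rintro _ ⟨h, rfl⟩
    exact (S.isIntertwining' h).symm
  exact commute_of_isCyclic_quotient (key S) (key T)

theorem range_toGL_eq_ker_det (F ι : Type*) [Field F] [Fintype ι] [DecidableEq ι] :
    (Matrix.SpecialLinearGroup.toGL (n := ι) (R := F)).range =
      (Matrix.GeneralLinearGroup.det (n := ι) (R := F)).ker := by
  ext A
  constructor
  · rintro ⟨B, rfl⟩
    exact Units.ext B.2
  · intro hA
    exact ⟨⟨A, congrArg Units.val hA⟩, Units.ext rfl⟩

instance normal_range_toGL (F ι : Type*) [Field F] [Fintype ι] [DecidableEq ι] :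
    (Matrix.SpecialLinearGroup.toGL (n := ι) (R := F)).range.Normal := by
  rw [range_toGL_eq_ker_det]
  infer_instance

theorem isCyclic_GL_quotient_range_toGL (F ι : Type*) [Field F] [Finite F] [Fintype ι]
    [DecidableEq ι] :
    IsCyclic (Matrix.GeneralLinearGroup ι F ⧸
      (Matrix.SpecialLinearGroup.toGL (n := ι) (R := F)).range) := by
  have : IsCyclic (Matrix.GeneralLinearGroup ι F ⧸
      (Matrix.GeneralLinearGroup.det (n := ι) (R := F)).ker) :=
    isCyclic_of_injective (QuotientGroup.kerLift _) (QuotientGroup.kerLift_injective _)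
  exact (QuotientGroup.quotientMulEquivOfEq (range_toGL_eq_ker_det F ι)).isCyclic.2 this

/-- The inner product of a restricted character with a character counts intertwining maps. -/
theorem charInner_comp_eq_finrank {G H : Type} [Group G] [Group H] [Finite H] (i : H →* G)
    (V : FDRep ℂ G) (W : FDRep ℂ H) :
    charInner H (fun h ↦ V.character (i h)) W.character =
      finrank ℂ (Representation.IntertwiningMap W.ρ (V.ρ.comp i)) := by
  have := Fintype.ofFinite H
  have : Invertible (Nat.card H : ℂ) :=
    invertibleOfNonzero (Nat.cast_ne_zero.2 Nat.card_pos.ne')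
  rw [← Representation.card_inv_mul_sum_char_mul_char_eq_finrank, charInner,
    finsum_eq_sum_of_fintype]
  simp only [Representation.character_inv]
  rfl

/-- Lusztig's multiplicity-freeness theorem for the regular embedding
`SLₙ(F_q) ⊆ GLₙ(F_q)`: the restriction to `SLₙ(F_q)` of any irreducible complex
character of `GLₙ(F_q)` is multiplicity-free. -/
theorem restriction_GL_to_SL_multiplicity_free
    (q : ℕ) (hq : IsPrimePow q) (F : Type) [Field F] [Fintype F]
    (hcard : Fintype.card F = q) (n : ℕ) (hn : 1 ≤ n)
    (χ : Matrix.GeneralLinearGroup (Fin n) F → ℂ)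
    (hχ : IsIrreducibleCharacter (Matrix.GeneralLinearGroup (Fin n) F) χ)
    (ρ : Matrix.SpecialLinearGroup (Fin n) F → ℂ)
    (hρ : IsIrreducibleCharacter (Matrix.SpecialLinearGroup (Fin n) F) ρ) :
    charInner (Matrix.SpecialLinearGroup (Fin n) F)
        (fun A => χ (Matrix.SpecialLinearGroup.toGL A)) ρ = 0 ∨
    charInner (Matrix.SpecialLinearGroup (Fin n) F)
        (fun A => χ (Matrix.SpecialLinearGroup.toGL A)) ρ = 1 := by
  obtain ⟨V, hV, rfl⟩ := hχ
  obtain ⟨W, hW, rfl⟩ := hρ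
  have hVirr := FDRep.isIrreducible_of_simple V
  have hWirr := FDRep.isIrreducible_of_simple W
  rw [charInner_comp_eq_finrank]
  have := isCyclic_GL_quotient_range_toGL F (Fin n)
  have hle := Representation.IsIrreducible.finrank_intertwiningMap_comp_le_one
    (Matrix.SpecialLinearGroup.toGL (n := Fin n) (R := F)) V.ρ W.ρ
  obtain h | h : _ = 0 ∨ _ = 1 := Nat.le_one_iff_eq_zero_or_eq_one.1 hle
  · exact .inl (by rw [h, Nat.cast_zero])
  · exact .inr (by rw [h, Nat.cast_one])
end
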